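/- arXiv:1902.06402 — 3 statements merged into one kernel-verified Lean document; each statement's English description precedes it below -/
import Mathlib

section
/- Let G be a finite even semi-cactus with at least two vertices. Then the prism G □ K₂ has a Hamiltonian cycle. -/
namespace IGraph

open SimpleGraph

universe u w

variable {V : Type u} {W : Type w}

/-- `G` is locally finite: every vertex has finite degree. -/
def LocFin (G : SimpleGraph V) : Prop := ∀ v : V, (G.neighborSet v).Finite

/-- A ray of `G`: a one-way infinite path, given by an injective sequence of
successively adjacent vertices. -/
def IsRay (G : SimpleGraph V) (R : ℕ → V) : Prop :=
  Function.Injective R ∧ ∀ n : ℕ, G.Adj (R n) (R (n + 1))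

/-- `G − S`, kept on the same vertex type (removed vertices become isolated). -/
def del (G : SimpleGraph V) (S : Set V) : SimpleGraph V where
  Adj a b := G.Adj a b ∧ a ∉ S ∧ b ∉ S
  symm := ⟨fun a b h => ⟨h.1.symm, h.2.2, h.2.1⟩⟩
  loopless := ⟨fun a h => G.loopless.irrefl a h.1⟩

/-- Two rays are equivalent in `G` if for every finite `S ⊆ V(G)` some component of
`G − S` contains a tail of both. -/
def RayEquiv (G : SimpleGraph V) (R₁ R₂ : ℕ → V) : Prop :=
  ∀ S : Set V, S.Finite →
    ∃ m n : ℕ, (∀ i, m ≤ i → R₁ i ∉ S) ∧ (∀ j, n ≤ j → R₂ j ∉ S) ∧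
      (del G S).Reachable (R₁ m) (R₂ n)

/-- `F` is a faithful subgraph of `G` (both presented on the same vertex type):
(1) every end of `G` contains a ray of `F`, and (2) two rays of `F` are equivalent in `F`
iff they are equivalent in `G`. -/
def Faithful (F G : SimpleGraph V) : Prop :=
  (∀ R : ℕ → V, IsRay G R → ∃ R' : ℕ → V, IsRay F R' ∧ RayEquiv G R R') ∧
  ∀ R₁ R₂ : ℕ → V, IsRay F R₁ → IsRay F R₂ → (RayEquiv F R₁ R₂ ↔ RayEquiv G R₁ R₂)

/-- `N_G(X)`: vertices outside `X` with a neighbor in `X`. -/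
def NSet (G : SimpleGraph V) (X : Set V) : Set V := {y | y ∉ X ∧ ∃ x ∈ X, G.Adj x y}

/-- `Z_G(X)`: vertices of `X` with a neighbor outside `X`. -/
def ZSet (G : SimpleGraph V) (X : Set V) : Set V := {x | x ∈ X ∧ ∃ y, y ∉ X ∧ G.Adj x y}

/-- The vertex set of the component of `G − S` containing `v`. -/
def compOf (G : SimpleGraph V) (S : Set V) (v : V) : Set V := {x | (del G S).Reachable v x}

/-- The degree of the end of `G` represented by the ray `R`: the supremum of the numbers of
pairwise vertex-disjoint rays equivalent to `R`. -/
noncomputable def endDegree (G : SimpleGraph V) (R : ℕ → V) : ℕ∞ :=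
  ⨆ n ∈ {n : ℕ | ∃ f : Fin n → ℕ → V,
      (∀ i, IsRay G (f i) ∧ RayEquiv G (f i) R) ∧
      ∀ i j, i ≠ j → Disjoint (Set.range (f i)) (Set.range (f j))}, (n : ℕ∞)

/-- `H` is `k`-connected: `|V(H)| > k` and removing fewer than `k` vertices leaves a
connected graph. -/
def IsKConn (k : ℕ) (H : SimpleGraph W) : Prop :=
  (k : Cardinal) < Cardinal.mk W ∧
    ∀ X : Set W, X.Finite → X.ncard < k → (H.induce Xᶜ).Connected

/-- Every vertex has degree at most 3. -/
def Subcubic (G : SimpleGraph V) : Prop :=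
  ∀ v : V, (G.neighborSet v).Finite ∧ (G.neighborSet v).ncard ≤ 3

/-- Every vertex has degree exactly 3. -/
def Cubic (G : SimpleGraph V) : Prop := ∀ v : V, (G.neighborSet v).ncard = 3

/-- `S` is 3-connected in `G`: every two vertices of `S` are joined by three pairwise
internally disjoint paths of `G`. -/
def ThreeConnIn (G : SimpleGraph V) (S : Set V) : Prop :=
  ∀ u v : V, u ∈ S → v ∈ S → u ≠ v →
    ∃ p₁ p₂ p₃ : G.Path u v,
      p₁ ≠ p₂ ∧ p₁ ≠ p₃ ∧ p₂ ≠ p₃ ∧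
      (∀ x, x ∈ (p₁ : G.Walk u v).support → x ∈ (p₂ : G.Walk u v).support → x = u ∨ x = v) ∧
      (∀ x, x ∈ (p₁ : G.Walk u v).support → x ∈ (p₃ : G.Walk u v).support → x = u ∨ x = v) ∧
      (∀ x, x ∈ (p₂ : G.Walk u v).support → x ∈ (p₃ : G.Walk u v).support → x = u ∨ x = v)

/-- A subgraph which is a (finite) cycle: finite, nonempty, connected and 2-regular. -/
def IsCycleSub {G : SimpleGraph W} (C : G.Subgraph) : Prop :=
  C.verts.Finite ∧ C.verts.Nonempty ∧ C.Connected ∧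
    ∀ v ∈ C.verts, (C.neighborSet v).ncard = 2

/-- A cactus: a connected subcubic graph whose cycles are pairwise vertex-disjoint and whose
edges decompose into vertex-disjoint cycles and vertex-disjoint paths (equivalently, every
vertex on no cycle has degree at most 2). -/
def IsCactus (H : SimpleGraph W) : Prop :=
  H.Connected ∧ Subcubic H ∧
  (∀ C₁ C₂ : H.Subgraph, IsCycleSub C₁ → IsCycleSub C₂ → C₁ ≠ C₂ →
    Disjoint C₁.verts C₂.verts) ∧
  ∀ v : W, (∀ C : H.Subgraph, IsCycleSub C → v ∉ C.verts) → (H.neighborSet v).ncard ≤ 2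

/-- A semi-cactus: connected, maximum degree at most 4, every block is a cycle or a `K₂`
(equivalently, distinct cycles are edge-disjoint), and every vertex lies in at most two
blocks (cycles through `v` together with bridges at `v` number at most 2). -/
def IsSemiCactus (H : SimpleGraph W) : Prop :=
  H.Connected ∧ (∀ v : W, (H.neighborSet v).Finite ∧ (H.neighborSet v).ncard ≤ 4) ∧
  (∀ C₁ C₂ : H.Subgraph, IsCycleSub C₁ → IsCycleSub C₂ → C₁ ≠ C₂ →
    Disjoint C₁.edgeSet C₂.edgeSet) ∧
  ∀ v : W,
    {C : H.Subgraph | IsCycleSub C ∧ v ∈ C.verts}.encard +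
      {e : Sym2 W | e ∈ H.edgeSet ∧ v ∈ e ∧
        ∀ C : H.Subgraph, IsCycleSub C → e ∉ C.edgeSet}.encard ≤ 2

/-- Every cycle of `H` is even. -/
def EvenCycles (H : SimpleGraph W) : Prop :=
  ∀ C : H.Subgraph, IsCycleSub C → Even C.verts.ncard

/-- `v` is a cut-vertex of `H`: removing `v` separates two vertices. -/
def IsCutVert (H : SimpleGraph W) (v : W) : Prop :=
  ∃ a b : W, a ≠ v ∧ b ≠ v ∧ H.Reachable a b ∧ ¬ (del H {v}).Reachable a b

/-- `H` is non-separable: connected without cut-vertices. -/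
def Nonseparable (H : SimpleGraph W) : Prop := H.Connected ∧ ∀ v : W, ¬ IsCutVert H v

/-- `B` is the vertex set of a block of `H`: a maximal set inducing a non-separable graph. -/
def IsBlockSet (H : SimpleGraph W) (B : Set W) : Prop :=
  Nonseparable (H.induce B) ∧ ∀ B' : Set W, B ⊆ B' → Nonseparable (H.induce B') → B' = B

/-- An end-block: a block containing at most one cut-vertex of `H`. -/
def IsEndBlock (H : SimpleGraph W) (B : Set W) : Prop :=
  IsBlockSet H B ∧ {v ∈ B | IsCutVert H v}.encard ≤ 1

/-- A block-chain: a connected graph whose block-cut tree is a path, i.e. every block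
contains at most two cut-vertices and every cut-vertex lies in at most two blocks. -/
def IsBlockChain (H : SimpleGraph W) : Prop :=
  H.Connected ∧
  (∀ B : Set W, IsBlockSet H B → {v ∈ B | IsCutVert H v}.encard ≤ 2) ∧
  ∀ v : W, IsCutVert H v → {B : Set W | IsBlockSet H B ∧ v ∈ B}.encard ≤ 2

/-- A block-chain connecting `u` and `v`: either `H` is non-separable, or `H` is separable
and `u`, `v` are non-cut vertices of two distinct end-blocks. -/
def BlockChainConn (H : SimpleGraph W) (u v : W) : Prop :=
  IsBlockChain H ∧
  (Nonseparable H ∨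
    ((∃ x, IsCutVert H x) ∧
      ∃ B₁ B₂ : Set W, IsEndBlock H B₁ ∧ IsEndBlock H B₂ ∧ B₁ ≠ B₂ ∧
        u ∈ B₁ ∧ v ∈ B₂ ∧ ¬ IsCutVert H u ∧ ¬ IsCutVert H v))

/-- The `k`-th power of `G`: vertices at distance at most `k` become adjacent. -/
def gpow (G : SimpleGraph V) (k : ℕ) : SimpleGraph V where
  Adj u v := u ≠ v ∧ ∃ p : G.Walk u v, p.length ≤ k
  symm := ⟨fun u v h => ⟨h.1.symm, by obtain ⟨p, hp⟩ := h.2; exact ⟨p.reverse, by simpa using hp⟩⟩⟩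
  loopless := ⟨fun v h => h.1 rfl⟩

/-- The copy `G × {d₀}` of `G` inside the Cartesian product `G □ D`. -/
def copyAt (G : SimpleGraph V) (d₀ : W) : SimpleGraph (V × W) where
  Adj p q := G.Adj p.1 q.1 ∧ p.2 = d₀ ∧ q.2 = d₀
  symm := ⟨fun p q h => ⟨h.1.symm, h.2.2, h.2.1⟩⟩
  loopless := ⟨fun p h => G.loopless.irrefl _ h.1⟩

/-- The line graph of the subgraph `F` of `G`, presented on the vertex set `E(G)` of the
line graph of `G` (edges of `G` not in `F` are isolated). -/
def lineSub (G F : SimpleGraph V) : SimpleGraph G.edgeSet where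
  Adj e f := (e : Sym2 V) ∈ F.edgeSet ∧ (f : Sym2 V) ∈ F.edgeSet ∧ e ≠ f ∧
    ∃ x : V, x ∈ (e : Sym2 V) ∧ x ∈ (f : Sym2 V)
  symm := ⟨fun e f h =>
    ⟨h.2.1, h.1, h.2.2.1.symm, by obtain ⟨x, h1, h2⟩ := h.2.2.2; exact ⟨x, h2, h1⟩⟩⟩
  loopless := ⟨fun e h => h.2.2.1 rfl⟩

/-- `B ⊆ V(G)` induces a cycle of `G`. -/
def IsCycleSet (G : SimpleGraph V) (B : Set V) : Prop :=
  B.Finite ∧ B.Nonempty ∧ (G.induce B).Connected ∧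
    ∀ v ∈ B, (G.neighborSet v ∩ B).ncard = 2

/-- Two edges lie in a common block: they are equal or lie on a common cycle. -/
def SameBlock (G : SimpleGraph V) (e f : Sym2 V) : Prop :=
  e = f ∨ ∃ C : G.Subgraph, IsCycleSub C ∧ e ∈ C.edgeSet ∧ f ∈ C.edgeSet

theorem SameBlock.trans {G : SimpleGraph V} (hsc : IsSemiCactus G) {e f g : Sym2 V}
    (h : SameBlock G e f) (h' : SameBlock G f g) : SameBlock G e g := by
  rcases h with rfl | ⟨C, hC, he, hf⟩
  · exact h'
  rcases h' with rfl | ⟨C', hC', hf', hg⟩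
  · exact Or.inr ⟨C, hC, he, hf⟩
  by_cases hCC : C = C'
  · subst hCC
    exact Or.inr ⟨C, hC, he, hg⟩
  · exact absurd hf' (Set.disjoint_left.mp (hsc.2.2.1 C C' hC hC' hCC) hf)

theorem SameBlock.mem_edgeSet {G : SimpleGraph V} {e f : Sym2 V} (h : SameBlock G e f)
    (he : e ∈ G.edgeSet) : f ∈ G.edgeSet := by
  rcases h with rfl | ⟨C, -, -, hf⟩
  · exact he
  · exact C.edgeSet_subset hf

/-- Among three edges at a vertex of a semi-cactus, two lie in a common block. -/
theorem IsSemiCactus.exists_sameBlock {G : SimpleGraph V} (hsc : IsSemiCactus G) {v : V}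
    {e₁ e₂ e₃ : Sym2 V} (h₁ : e₁ ∈ G.edgeSet) (h₂ : e₂ ∈ G.edgeSet) (h₃ : e₃ ∈ G.edgeSet)
    (v₁ : v ∈ e₁) (v₂ : v ∈ e₂) (v₃ : v ∈ e₃) :
    SameBlock G e₁ e₂ ∨ SameBlock G e₁ e₃ ∨ SameBlock G e₂ e₃ := by
  classical
  let block : Sym2 V → G.Subgraph ⊕ Sym2 V := fun e =>
    if h : ∃ C : G.Subgraph, IsCycleSub C ∧ e ∈ C.edgeSet then Sum.inl h.choose else Sum.inr e
  have same : ∀ e f, block e = block f → SameBlock G e f := by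
    intro e f hef
    by_cases h : ∃ C : G.Subgraph, IsCycleSub C ∧ e ∈ C.edgeSet <;>
    by_cases h' : ∃ C : G.Subgraph, IsCycleSub C ∧ f ∈ C.edgeSet
    · simp only [block, dif_pos h, dif_pos h', Sum.inl.injEq] at hef
      exact Or.inr ⟨h.choose, h.choose_spec.1, h.choose_spec.2, hef ▸ h'.choose_spec.2⟩
    · simp [block, dif_pos h, dif_neg h'] at hef
    · simp [block, dif_neg h, dif_pos h'] at hef
    · simp only [block, dif_neg h, dif_neg h', Sum.inr.injEq] at hef
      exact Or.inl hef
  have hv := hsc.2.2.2 v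
  set A : Set G.Subgraph := {C | IsCycleSub C ∧ v ∈ C.verts}
  set B : Set (Sym2 V) := {e | e ∈ G.edgeSet ∧ v ∈ e ∧
        ∀ C : G.Subgraph, IsCycleSub C → e ∉ C.edgeSet}
  have mem : ∀ e, e ∈ G.edgeSet → v ∈ e → block e ∈ Sum.inl '' A ∪ Sum.inr '' B := by
    intro e he hve
    by_cases h : ∃ C : G.Subgraph, IsCycleSub C ∧ e ∈ C.edgeSet
    · simp only [block, dif_pos h]
      exact Or.inl ⟨_, ⟨h.choose_spec.1, h.choose.mem_verts_of_mem_edge h.choose_spec.2 hve⟩, rfl⟩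
    · simp only [block, dif_neg h]
      push Not at h
      exact Or.inr ⟨_, ⟨he, hve, h⟩, rfl⟩
  by_contra! hne
  have hcard : ({block e₁, block e₂, block e₃} : Set (G.Subgraph ⊕ Sym2 V)).encard = 3 :=
    Set.encard_eq_three.mpr ⟨_, _, _, fun h => hne.1 (same _ _ h), fun h => hne.2.1 (same _ _ h),
      fun h => hne.2.2 (same _ _ h), rfl⟩
  have hsub : ({block e₁, block e₂, block e₃} : Set (G.Subgraph ⊕ Sym2 V)) ⊆
      Sum.inl '' A ∪ Sum.inr '' B := by
    rintro x (rfl | rfl | rfl)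
    exacts [mem _ h₁ v₁, mem _ h₂ v₂, mem _ h₃ v₃]
  have hle := (Set.encard_le_encard hsub).trans (Set.encard_union_le _ _)
  rw [hcard, Sum.inl_injective.encard_image, Sum.inr_injective.encard_image] at hle
  exact absurd (hle.trans hv) (by decide)

theorem isCycleSub_toSubgraph {G : SimpleGraph V} {u : V} {p : G.Walk u u} (hp : p.IsCycle) :
    IsCycleSub p.toSubgraph := by
  refine ⟨?_, ⟨u, p.start_mem_verts_toSubgraph⟩, p.toSubgraph_connected, fun v hv =>
    hp.ncard_neighborSet_toSubgraph_eq_two (p.mem_verts_toSubgraph.mp hv)⟩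
  rw [p.verts_toSubgraph]
  exact p.support.finite_toSet

/-- An edge of a cycle subgraph lies on a cycle of the ambient graph, given as a walk. -/
theorem IsCycleSub.exists_isCycle [Finite V] {G : SimpleGraph V} {C : G.Subgraph}
    (hC : IsCycleSub C) {u w : V} (h : C.Adj u w) :
    ∃ (x : V) (p : G.Walk x x), p.IsCycle ∧ s(u, w) ∈ p.edges := by
  have hcyc : C.spanningCoe.IsCycles := by
    rintro v ⟨x, hx⟩
    exact hC.2.2.2 v (C.edge_vert hx)
  obtain ⟨x, p, hp, he⟩ := adj_and_reachable_delete_edges_iff_exists_cycle.mp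
    ⟨(show C.spanningCoe.Adj u w from h), hcyc.reachable_deleteEdges h⟩
  exact ⟨x, p.mapLe C.spanningCoe_le, hp.mapLe _, by simpa using he⟩

/-- The graph whose edges join consecutive terms of `f 0, f 1, …, f n`. -/
def traceGraph (f : ℕ → V) (n : ℕ) : SimpleGraph V :=
  fromEdgeSet {e | ∃ i < n, e = s(f i, f (i + 1))}

theorem traceGraph_adj {f : ℕ → V} {n : ℕ} {a b : V} :
    (traceGraph f n).Adj a b ↔ (∃ i < n, s(a, b) = s(f i, f (i + 1))) ∧ a ≠ b := by
  simp [traceGraph]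

theorem traceGraph_reachable_zero {f : ℕ → V} {n : ℕ} {i : ℕ} (hi : i ≤ n) :
    (traceGraph f n).Reachable (f 0) (f i) := by
  induction i with
  | zero => exact Reachable.refl _
  | succ i ih =>
    refine (ih (by omega)).trans ?_
    by_cases h : f i = f (i + 1)
    · rw [h]
    · exact Adj.reachable (traceGraph_adj.mpr ⟨⟨i, by omega, rfl⟩, h⟩)

theorem traceGraph_ncard_neighborSet {f : ℕ → V} {n : ℕ} (hn : 3 ≤ n) (hf : f n = f 0)
    (hinj : Set.InjOn f {i | i < n}) {i : ℕ} (hi : i < n) :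
    ((traceGraph f n).neighborSet (f i)).ncard = 2 := by
  have inj : ∀ {a b}, a < n → b < n → f a = f b → a = b := fun ha hb h => hinj ha hb h
  rw [Set.ncard_eq_two]
  rcases Nat.eq_zero_or_pos i with rfl | hpos
  · refine ⟨f 1, f (n - 1), fun h => ?_, ?_⟩
    · have := inj (by omega) (by omega) h
      omega
    ext x
    simp only [mem_neighborSet, traceGraph_adj, Set.mem_insert_iff, Set.mem_singleton_iff]
    constructor
    · rintro ⟨⟨j, hj, h⟩, -⟩
      rcases Sym2.eq_iff.mp h with ⟨h1, h2⟩ | ⟨h1, h2⟩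
      · obtain rfl := inj (by omega) hj h1
        exact Or.inl h2
      · rcases Nat.lt_or_ge (j + 1) n with hj' | hj'
        · have := inj (by omega) hj' h1
          omega
        · obtain rfl : j = n - 1 := by omega
          exact Or.inr h2
    · rintro (rfl | rfl)
      · refine ⟨⟨0, by omega, rfl⟩, fun h => ?_⟩
        have := inj (by omega) (by omega) h
        omega
      · refine ⟨⟨n - 1, by omega, ?_⟩, fun h => ?_⟩
        · rw [Nat.sub_add_cancel (by omega), hf]
          exact Sym2.eq_swap
        · have := inj (by omega) (by omega) h
          omega
  · have hnext : f (i + 1) ≠ f i ∧ f (i + 1) ≠ f (i - 1) := by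
      rcases Nat.lt_or_ge (i + 1) n with h | h
      · constructor <;> intro he <;> have := inj h (by omega) he <;> omega
      · rw [show i + 1 = n by omega, hf]
        constructor <;> intro he <;> have := inj (by omega) (by omega) he <;> omega
    refine ⟨f (i + 1), f (i - 1), hnext.2, ?_⟩
    ext x
    simp only [mem_neighborSet, traceGraph_adj, Set.mem_insert_iff, Set.mem_singleton_iff]
    constructor
    · rintro ⟨⟨j, hj, h⟩, -⟩
      rcases Sym2.eq_iff.mp h with ⟨h1, h2⟩ | ⟨h1, h2⟩
      · obtain rfl := inj hi hj h1
        exact Or.inl h2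
      · rcases Nat.lt_or_ge (j + 1) n with hj' | hj'
        · obtain rfl := inj hi hj' h1
          exact Or.inr h2
        · rw [show j + 1 = n by omega, hf] at h1
          have := inj hi (by omega) h1
          omega
    · rintro (rfl | rfl)
      · exact ⟨⟨i, hi, rfl⟩, hnext.1.symm⟩
      · refine ⟨⟨i - 1, by omega, ?_⟩, fun h => ?_⟩
        · rw [Nat.sub_add_cancel hpos]
          exact Sym2.eq_swap
        · have := inj hi (by omega) h
          omega

/-- `F` is a Hamiltonian cycle of the prism over the vertex set `S`, presented as a connected
`2`-regular graph. -/
structure IsPrismCycle (G : SimpleGraph V) (S : Set V) (F : SimpleGraph (V × Fin 2)) : Prop where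
  le : F ≤ G.boxProd (⊤ : SimpleGraph (Fin 2))
  mem : ∀ x y, F.Adj x y → x.1 ∈ S
  ncard : ∀ x : V × Fin 2, x.1 ∈ S → (F.neighborSet x).ncard = 2
  reach : ∀ x y : V × Fin 2, x.1 ∈ S → y.1 ∈ S → F.Reachable x y

theorem IsPrismCycle.isCycles {G : SimpleGraph V} {S : Set V} {F : SimpleGraph (V × Fin 2)}
    (h : IsPrismCycle G S F) : F.IsCycles := by
  rintro x ⟨y, hy⟩
  exact h.ncard x (h.mem x y hy)

/-- The closed sequence in the prism over `p 0, p 1, …` that traverses every vertical edge. -/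
def prismSeq (p : ℕ → V) (j : ℕ) : V × Fin 2 :=
  (p (j / 2), if j % 4 = 0 ∨ j % 4 = 3 then 0 else 1)

theorem isPrismCycle_traceGraph_prismSeq {G : SimpleGraph V} {p : ℕ → V} {n : ℕ} (hn : 2 ≤ n)
    (heven : Even n) (hp : p n = p 0) (hinj : Set.InjOn p {i | i < n})
    (hadj : ∀ i < n, G.Adj (p i) (p (i + 1))) :
    IsPrismCycle G (p '' {i | i < n}) (traceGraph (prismSeq p) (2 * n)) ∧
      ∀ v ∈ p '' {i | i < n}, (traceGraph (prismSeq p) (2 * n)).Adj (v, 0) (v, 1) := by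
  obtain ⟨k, rfl⟩ := heven
  have hclosed : prismSeq p (2 * (k + k)) = prismSeq p 0 := by
    have h1 : 2 * (k + k) / 2 = k + k := by omega
    have h2 : 2 * (k + k) % 4 = 0 := by omega
    simp [prismSeq, h1, h2, hp]
  have hseq : Set.InjOn (prismSeq p) {j | j < 2 * (k + k)} := by
    intro a ha b hb hab
    simp only [Set.mem_ofPred_eq] at ha hb
    simp only [prismSeq, Prod.mk.injEq] at hab
    have h1 : a / 2 = b / 2 := hinj (show a / 2 < k + k by omega)
      (show b / 2 < k + k by omega) hab.1
    have h2 := hab.2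
    split_ifs at h2 <;> omega
  have hmem : ∀ x : V × Fin 2, x.1 ∈ p '' {i | i < k + k} →
      ∃ j < 2 * (k + k), prismSeq p j = x := by
    rintro ⟨v, a⟩ ⟨i, hi, rfl⟩
    simp only [Set.mem_ofPred_eq] at hi
    have h1 : 2 * i / 2 = i := by omega
    have h2 : (2 * i + 1) / 2 = i := by omega
    rcases Nat.mod_two_eq_zero_or_one i with h | h
    · have h3 : 2 * i % 4 = 0 := by omega
      have h4 : (2 * i + 1) % 4 = 1 := by omega
      fin_cases a
      · exact ⟨2 * i, by omega, by simp [prismSeq, h1, h3]⟩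
      · exact ⟨2 * i + 1, by omega, by simp [prismSeq, h2, h4]⟩
    · have h3 : 2 * i % 4 = 2 := by omega
      have h4 : (2 * i + 1) % 4 = 3 := by omega
      fin_cases a
      · exact ⟨2 * i + 1, by omega, by simp [prismSeq, h2, h4]⟩
      · exact ⟨2 * i, by omega, by simp [prismSeq, h1, h3]⟩
  have hfst : ∀ j ≤ 2 * (k + k), (prismSeq p j).1 ∈ p '' {i | i < k + k} := by
    intro j hj
    rcases hj.eq_or_lt with rfl | hj
    · rw [hclosed]
      exact ⟨0, show 0 < k + k by omega, rfl⟩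
    · exact ⟨j / 2, show j / 2 < k + k by omega, rfl⟩
  have hstep : ∀ j < 2 * (k + k),
      (G.boxProd (⊤ : SimpleGraph (Fin 2))).Adj (prismSeq p j) (prismSeq p (j + 1)) := by
    intro j hj
    rw [boxProd_adj]
    rcases Nat.mod_two_eq_zero_or_one j with h | h
    · right
      have h1 : (j + 1) / 2 = j / 2 := by omega
      simp only [prismSeq, h1, top_adj, and_true]
      split_ifs <;> omega
    · left
      have h1 : (j + 1) / 2 = j / 2 + 1 := by omega
      simp only [prismSeq, h1]
      refine ⟨hadj _ (by omega), ?_⟩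
      split_ifs <;> omega
  refine ⟨⟨?_, ?_, ?_, ?_⟩, ?_⟩
  · intro x y hxy
    obtain ⟨⟨j, hj, h⟩, -⟩ := traceGraph_adj.mp hxy
    rcases Sym2.eq_iff.mp h with ⟨rfl, rfl⟩ | ⟨rfl, rfl⟩
    exacts [hstep j hj, (hstep j hj).symm]
  · intro x y hxy
    obtain ⟨⟨j, hj, h⟩, -⟩ := traceGraph_adj.mp hxy
    rcases Sym2.eq_iff.mp h with ⟨rfl, rfl⟩ | ⟨rfl, rfl⟩
    exacts [hfst j (by omega), hfst (j + 1) (by omega)]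
  · intro x hx
    obtain ⟨j, hj, rfl⟩ := hmem x hx
    exact traceGraph_ncard_neighborSet (by omega) hclosed hseq hj
  · intro x y hx hy
    obtain ⟨i, hi, rfl⟩ := hmem x hx
    obtain ⟨j, hj, rfl⟩ := hmem y hy
    exact (traceGraph_reachable_zero hi.le).symm.trans (traceGraph_reachable_zero hj.le)
  · rintro v ⟨i, hi, rfl⟩
    simp only [Set.mem_ofPred_eq] at hi
    refine traceGraph_adj.mpr ⟨⟨2 * i, by omega, ?_⟩, by simp⟩
    have h1 : 2 * i / 2 = i := by omega
    have h2 : (2 * i + 1) / 2 = i := by omega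
    rcases Nat.mod_two_eq_zero_or_one i with h | h
    · have h3 : 2 * i % 4 = 0 := by omega
      have h4 : (2 * i + 1) % 4 = 1 := by omega
      simp [prismSeq, h1, h2, h3, h4]
    · have h3 : 2 * i % 4 = 2 := by omega
      have h4 : (2 * i + 1) % 4 = 3 := by omega
      simp [prismSeq, h1, h2, h3, h4, Sym2.eq_swap]

theorem IsPrismCycle.deleteEdges_reachable [Finite V] {G : SimpleGraph V} {S : Set V}
    {F : SimpleGraph (V × Fin 2)} (h : IsPrismCycle G S F) {a b : V × Fin 2} (hab : F.Adj a b)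
    {x y : V × Fin 2} (hx : x.1 ∈ S) (hy : y.1 ∈ S) :
    (F.deleteEdges {s(a, b)}).Reachable x y := by
  have hdel := h.isCycles.reachable_deleteEdges hab
  obtain ⟨p⟩ := h.reach x y hx hy
  clear hx hy
  induction p with
  | nil => exact Reachable.refl _
  | @cons c d _ hcd _ ih =>
    refine Reachable.trans ?_ ih
    by_cases he : s(c, d) = s(a, b)
    · rcases Sym2.eq_iff.mp he with ⟨rfl, rfl⟩ | ⟨rfl, rfl⟩
      exacts [hdel, hdel.symm]
    · exact Adj.reachable (deleteEdges_adj.mpr ⟨hcd, he⟩)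

/-- Two prism cycles over vertex sets meeting in `u` merge along the vertical edge at `u`. -/
theorem IsPrismCycle.merge [Finite V] {G : SimpleGraph V} {S B : Set V} {u : V}
    {F F' : SimpleGraph (V × Fin 2)} (h : IsPrismCycle G S F) (h' : IsPrismCycle G B F')
    (huS : u ∈ S) (huB : u ∈ B) (hSB : ∀ x ∈ S, x ∈ B → x = u)
    (hF : F.Adj (u, 0) (u, 1)) (hF' : F'.Adj (u, 0) (u, 1)) :
    IsPrismCycle G (S ∪ B) ((F ⊔ F').deleteEdges {s((u, 0), (u, 1))}) := by
  have reach_left : ∀ x y : V × Fin 2, x.1 ∈ S → y.1 ∈ S →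
      ((F ⊔ F').deleteEdges {s((u, 0), (u, 1))}).Reachable x y := fun x y hx hy =>
    (h.deleteEdges_reachable hF hx hy).mono (deleteEdges_mono le_sup_left)
  have reach_right : ∀ x y : V × Fin 2, x.1 ∈ B → y.1 ∈ B →
      ((F ⊔ F').deleteEdges {s((u, 0), (u, 1))}).Reachable x y := fun x y hx hy =>
    (h'.deleteEdges_reachable hF' hx hy).mono (deleteEdges_mono le_sup_right)
  have ncard_apex : ∀ x x' : V × Fin 2, x.1 = u → x'.1 = u → s(x, x') = s((u, 0), (u, 1)) →
      F.Adj x x' → F'.Adj x x' →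
      (((F ⊔ F').deleteEdges {s((u, 0), (u, 1))}).neighborSet x).ncard = 2 := by
    intro x x' hx hx' he hxx hxx'
    have hset : ((F ⊔ F').deleteEdges {s((u, 0), (u, 1))}).neighborSet x =
        (F.neighborSet x \ {x'}) ∪ (F'.neighborSet x \ {x'}) := by
      ext y
      simp only [mem_neighborSet, deleteEdges_adj, sup_adj, ← he, Set.mem_singleton_iff,
        Set.mem_union, Set.mem_sdiff, Sym2.congr_right]
      tauto
    have hdisj : Disjoint (F.neighborSet x \ {x'}) (F'.neighborSet x \ {x'}) := by
      rw [Set.disjoint_left]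
      rintro y ⟨hy, hne⟩ ⟨hy', -⟩
      have hyu := hSB y.1 (h.mem y x (Adj.symm hy)) (h'.mem y x (Adj.symm hy'))
      have hyx : y ≠ x := (F.ne_of_adj hy).symm
      have hxx'ne := F.ne_of_adj hxx
      obtain ⟨y1, y2⟩ := y
      obtain ⟨x1, x2⟩ := x
      obtain ⟨z1, z2⟩ := x'
      simp only [Set.mem_singleton_iff, Prod.mk.injEq, not_and, ne_eq] at *
      subst hx hx' hyu
      simp only [forall_const] at *
      omega
    rw [hset, Set.ncard_union_eq hdisj, Set.ncard_sdiff_singleton_of_mem (s := F.neighborSet x) hxx,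
      Set.ncard_sdiff_singleton_of_mem (s := F'.neighborSet x) hxx', h.ncard x (hx ▸ huS), h'.ncard x (hx ▸ huB)]
  refine ⟨?_, ?_, ?_, ?_⟩
  · exact (deleteEdges_le _).trans (sup_le h.le h'.le)
  · intro x y hxy
    rcases (deleteEdges_adj.mp hxy).1 with hxy | hxy
    exacts [Or.inl (h.mem x y hxy), Or.inr (h'.mem x y hxy)]
  · rintro ⟨x, a⟩ hx
    by_cases hxu : x = u
    · subst hxu
      fin_cases a
      · exact ncard_apex (x, 0) (x, 1) rfl rfl rfl hF hF'
      · exact ncard_apex (x, 1) (x, 0) rfl rfl Sym2.eq_swap hF.symm hF'.symm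
    · have hne : ∀ y, s((x, a), y) ∉ ({s((u, 0), (u, 1))} : Set (Sym2 (V × Fin 2))) := by
        intro y hy
        rcases Sym2.eq_iff.mp hy with ⟨h1, -⟩ | ⟨h1, -⟩ <;> exact hxu (congrArg Prod.fst h1)
      rcases hx with hx | hx
      · refine Eq.trans (congrArg Set.ncard ?_) (h.ncard (x, a) hx)
        ext y
        simp only [mem_neighborSet, deleteEdges_adj, hne, not_false_eq_true, and_true, sup_adj,
          or_iff_left_iff_imp]
        exact fun hy => absurd (hSB x hx (h'.mem _ _ hy)) hxu
      · refine Eq.trans (congrArg Set.ncard ?_) (h'.ncard (x, a) hx)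
        ext y
        simp only [mem_neighborSet, deleteEdges_adj, hne, not_false_eq_true, and_true, sup_adj,
          or_iff_right_iff_imp]
        exact fun hy => absurd (hSB x (h.mem _ _ hy) hx) hxu
  · rintro x y (hx | hx) (hy | hy)
    · exact reach_left x y hx hy
    · exact (reach_left x (u, 0) hx huS).trans (reach_right (u, 0) y huB hy)
    · exact (reach_right x (u, 0) hx huB).trans (reach_left (u, 0) y huS hy)
    · exact reach_right x y hx hy

/-- The block of an edge of a semi-cactus with even cycles, enumerated cyclically (a bridge is
enumerated as a closed sequence of length two). -/
theorem EvenCycles.exists_block_enumeration [Finite V] {G : SimpleGraph V}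
    (hsc : IsSemiCactus G) (he : EvenCycles G) {u w : V} (huw : G.Adj u w) :
    ∃ (n : ℕ) (p : ℕ → V), 2 ≤ n ∧ Even n ∧ p 0 = u ∧ p n = p 0 ∧
      Set.InjOn p {i | i < n} ∧
      ∀ e, SameBlock G s(u, w) e ↔ ∃ i < n, e = s(p i, p (i + 1)) := by
  classical
  by_cases hcyc : ∃ C : G.Subgraph, IsCycleSub C ∧ C.Adj u w
  · obtain ⟨C₀, hC₀, hadj₀⟩ := hcyc
    obtain ⟨x, p₀, hp₀, he₀⟩ := hC₀.exists_isCycle hadj₀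
    have hu : u ∈ p₀.support := p₀.fst_mem_support_of_mem_edges he₀
    obtain ⟨p, hp, hpe⟩ : ∃ p : G.Walk u u, p.IsCycle ∧ s(u, w) ∈ p.edges :=
      ⟨p₀.rotate u hu, hp₀.rotate hu, (p₀.rotate_edges u hu).mem_iff.mpr he₀⟩
    have hC := isCycleSub_toSubgraph hp
    have hinj : Set.InjOn p.getVert {i | i < p.length} :=
      fun a ha b hb hab => hp.getVert_injOn' (by simp at *; omega) (by simp at *; omega) hab
    have hverts : p.toSubgraph.verts = p.getVert '' {i | i < p.length} := by
      ext v
      rw [p.mem_verts_toSubgraph, p.mem_support_iff_exists_getVert]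
      constructor
      · rintro ⟨i, rfl, hi⟩
        rcases hi.eq_or_lt with rfl | hi
        · refine ⟨0, ?_, by simp⟩
          have := hp.three_le_length
          simp; omega
        · exact ⟨i, hi, rfl⟩
      · rintro ⟨i, hi, rfl⟩
        exact ⟨i, rfl, le_of_lt hi⟩
    refine ⟨p.length, p.getVert, by linarith [hp.three_le_length], ?_, p.getVert_zero,
      by simp, hinj, fun e => ?_⟩
    · have := he _ hC
      have hrange : {i | i < p.length} = (Finset.range p.length : Set ℕ) := by
        ext i
        simp
      rwa [hverts, hinj.ncard_image, hrange, Set.ncard_coe_finset, Finset.card_range] at this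
    · have hmem : SameBlock G s(u, w) e ↔ e ∈ p.toSubgraph.edgeSet := by
        constructor
        · rintro (rfl | ⟨C, hC', h1, h2⟩)
          · exact p.mem_edges_toSubgraph.mpr hpe
          · by_cases hCC : C = p.toSubgraph
            · exact hCC ▸ h2
            · exact absurd (p.mem_edges_toSubgraph.mpr hpe)
                (Set.disjoint_left.mp (hsc.2.2.1 _ _ hC' hC hCC) h1)
        · exact fun h => Or.inr ⟨_, hC, p.mem_edges_toSubgraph.mpr hpe, h⟩
      rw [hmem]
      induction e with | _ a b
      rw [Subgraph.mem_edgeSet, p.toSubgraph_adj_iff]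
      constructor
      · rintro ⟨i, h1, h2⟩
        exact ⟨i, h2, h1.symm⟩
      · rintro ⟨i, h1, h2⟩
        exact ⟨i, h2.symm, h1⟩
  · refine ⟨2, fun i => if i % 2 = 0 then u else w, le_rfl, even_two, by simp, by simp, ?_, ?_⟩
    · intro a ha b hb hab
      simp only [Set.mem_ofPred_eq] at ha hb
      dsimp only at hab
      split_ifs at hab with h1 h2 h2
      · omega
      · exact absurd hab huw.ne
      · exact absurd hab.symm huw.ne
      · omega
    · intro e
      constructor
      · rintro (rfl | ⟨C, hC, h1, -⟩)
        · exact ⟨0, by omega, by simp⟩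
        · exact absurd ⟨C, hC, h1⟩ hcyc
      · rintro ⟨i, hi, rfl⟩
        left
        interval_cases i
        · simp
        · simp [Sym2.eq_swap]

/-- A connected union `H` of blocks of `G` with vertex set `S`, and a Hamiltonian cycle `F` of
its prism which uses the vertical edge at every vertex that lies in a further block. -/
structure IsBlockUnion (G : SimpleGraph V) (S : Set V) (H : SimpleGraph V)
    (F : SimpleGraph (V × Fin 2)) : Prop where
  le : H ≤ G
  mem : ∀ a b, H.Adj a b → a ∈ S
  exists_adj : ∀ v ∈ S, ∃ w, H.Adj v w
  reach : ∀ a b, a ∈ S → b ∈ S → H.Reachable a b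
  closed : ∀ a b c d, H.Adj a b → SameBlock G s(a, b) s(c, d) → H.Adj c d
  cycle : IsPrismCycle G S F
  vertical : ∀ v ∈ S, F.Adj (v, 0) (v, 1) ∨ ∀ w, G.Adj v w → H.Adj v w

/-- The block of an edge `uw` as a block union, with all vertical edges used in its prism; it stays
connected when `u` is removed. -/
theorem EvenCycles.exists_isBlockUnion_of_adj [Finite V] {G : SimpleGraph V}
    (hsc : IsSemiCactus G) (he : EvenCycles G) {u w : V} (huw : G.Adj u w) :
    ∃ (B : Set V) (D : SimpleGraph V) (F : SimpleGraph (V × Fin 2)), IsBlockUnion G B D F ∧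
      (∀ v ∈ B, F.Adj (v, 0) (v, 1)) ∧ (∀ a b, D.Adj a b ↔ SameBlock G s(u, w) s(a, b)) ∧
      ∀ x ∈ B, x ≠ u → (del D {u}).Reachable w x := by
  obtain ⟨n, p, hn, heven, hp0, hpn, hinj, hblock⟩ := he.exists_block_enumeration hsc huw
  have hadj : ∀ i < n, G.Adj (p i) (p (i + 1)) := fun i hi =>
    ((hblock _).mpr ⟨i, hi, rfl⟩).mem_edgeSet huw
  have hD : ∀ a b, (traceGraph p n).Adj a b ↔ SameBlock G s(u, w) s(a, b) := by
    intro a b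
    rw [traceGraph_adj, hblock, and_iff_left_iff_imp]
    intro h
    exact G.ne_of_adj (((hblock _).mpr h).mem_edgeSet huw)
  have hfst : ∀ i ≤ n, p i ∈ p '' {i | i < n} := by
    intro i hi
    rcases hi.eq_or_lt with rfl | hi
    · exact ⟨0, show 0 < i by omega, hpn.symm⟩
    · exact ⟨i, hi, rfl⟩
  have hmem : ∀ a b, (traceGraph p n).Adj a b → a ∈ p '' {i | i < n} := by
    intro a b hab
    obtain ⟨⟨i, hi, h⟩, -⟩ := traceGraph_adj.mp hab
    rcases Sym2.eq_iff.mp h with ⟨rfl, -⟩ | ⟨rfl, -⟩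
    exacts [hfst i hi.le, hfst (i + 1) hi]
  obtain ⟨hcyc, hvert⟩ := isPrismCycle_traceGraph_prismSeq hn heven hpn hinj hadj
  have hne : ∀ i, 0 < i → i < n → p i ≠ u := by
    intro i h0 hi h
    have := hinj (show i < n from hi) (show 0 < n by omega) (h.trans hp0.symm)
    omega
  have hreach : ∀ i, 1 ≤ i → i < n → (del (traceGraph p n) {u}).Reachable (p 1) (p i) := by
    intro i h1
    induction i, h1 using Nat.le_induction with
    | base => exact fun _ => Reachable.refl _
    | succ i h1 ih =>
      intro hi
      refine (ih (by omega)).trans (Adj.reachable ⟨?_, hne _ (by omega) (by omega),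
        hne _ (by omega) hi⟩)
      exact traceGraph_adj.mpr ⟨⟨i, by omega, rfl⟩, (hadj i (by omega)).ne⟩
  have hreach' : ∀ x ∈ p '' {i | i < n}, x ≠ u →
      (del (traceGraph p n) {u}).Reachable (p 1) x := by
    rintro x ⟨i, hi, rfl⟩ hx
    refine hreach i ?_ hi
    rcases Nat.eq_zero_or_pos i with rfl | h
    · exact absurd hp0 hx
    · exact h
  refine ⟨_, traceGraph p n, _, ⟨?_, hmem, ?_, ?_, ?_, hcyc, fun v hv => Or.inl (hvert v hv)⟩,
    hvert, hD, ?_⟩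
  · exact fun a b hab => ((hD a b).mp hab).mem_edgeSet huw
  · rintro v ⟨i, hi, rfl⟩
    exact ⟨p (i + 1), traceGraph_adj.mpr ⟨⟨i, hi, rfl⟩, (hadj i hi).ne⟩⟩
  · rintro a b ⟨i, hi, rfl⟩ ⟨j, hj, rfl⟩
    exact (traceGraph_reachable_zero (le_of_lt hi)).symm.trans
      (traceGraph_reachable_zero (le_of_lt hj))
  · exact fun a b c d hab h => (hD c d).mpr (((hD a b).mp hab).trans hsc h)
  · intro x hx hxu
    have hw : w ∈ p '' {i | i < n} := hmem w u ((hD w u).mpr (Or.inl Sym2.eq_swap))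
    exact (hreach' w hw huw.ne').symm.trans (hreach' x hx hxu)

/-- A block leaving a block union at `u` meets it only in `u`. -/
theorem IsBlockUnion.inter_block [Finite V] {G H D : SimpleGraph V} {S : Set V}
    {F : SimpleGraph (V × Fin 2)} (h : IsBlockUnion G S H F) {u w x : V} (hu : u ∈ S)
    (hw : w ∉ S) (huw : G.Adj u w) (hDG : D ≤ G) (hx : x ∈ S)
    (hreach : (del D {u}).Reachable w x) : x = u := by
  by_contra hxu
  set K : SimpleGraph V := H ⊔ del D {u} ⊔ edge u w
  have hKG : K ≤ G := by
    refine sup_le (sup_le h.le fun a b hab => hDG hab.1) ?_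
    rw [edge_le_iff]
    exact Or.inr huw
  have hKuw : K.Adj u w := Or.inr (by simp [edge_adj, huw.ne])
  have hH : H ≤ K.deleteEdges {s(u, w)} := by
    intro a b hab
    refine deleteEdges_adj.mpr ⟨Or.inl (Or.inl hab), fun heq => ?_⟩
    rcases Sym2.eq_iff.mp heq with ⟨rfl, rfl⟩ | ⟨rfl, rfl⟩
    exacts [hw (h.mem _ _ hab.symm), hw (h.mem _ _ hab)]
  have hdel : del D {u} ≤ K.deleteEdges {s(u, w)} := by
    intro a b hab
    refine deleteEdges_adj.mpr ⟨Or.inl (Or.inr hab), fun heq => ?_⟩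
    rcases Sym2.eq_iff.mp heq with ⟨rfl, rfl⟩ | ⟨rfl, rfl⟩
    exacts [hab.2.1 rfl, hab.2.2 rfl]
  obtain ⟨y, c, hc, hce⟩ := adj_and_reachable_delete_edges_iff_exists_cycle.mp
    ⟨hKuw, ((h.reach u x hu hx).mono hH).trans (hreach.mono hdel).symm⟩
  have hC := isCycleSub_toSubgraph (hc.mapLe hKG)
  have huwC : (c.mapLe hKG).toSubgraph.Adj u w := by
    rw [Walk.adj_toSubgraph_iff_mem_edges]
    simpa using hce
  obtain ⟨z, hz, hzw⟩ : ∃ z, (c.mapLe hKG).toSubgraph.Adj u z ∧ z ≠ w := by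
    obtain ⟨z, hz, hzw⟩ := Set.exists_ne_of_one_lt_ncard
      (show 1 < ((c.mapLe hKG).toSubgraph.neighborSet u).ncard by
        rw [hC.2.2.2 u (Subgraph.edge_vert _ huwC)]; norm_num) w
    exact ⟨z, hz, hzw⟩
  have hKz : K.Adj u z := c.toSubgraph.adj_sub ((Walk.adj_toSubgraph_mapLe hKG).mp hz)
  rcases hKz with (hHz | hDz) | hez
  · exact hw (h.mem _ _ (h.closed u z u w hHz (Or.inr ⟨_, hC, hz, huwC⟩)).symm)
  · exact hDz.2.1 rfl
  · rw [edge_adj] at hez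
    rcases hez.1 with ⟨-, h1⟩ | ⟨h1, -⟩
    exacts [hzw h1, huw.ne h1]

theorem IsBlockUnion.exists_extension [Finite V] {G H : SimpleGraph V} {S : Set V}
    {F : SimpleGraph (V × Fin 2)} (hsc : IsSemiCactus G) (he : EvenCycles G)
    (h : IsBlockUnion G S H F) {u w : V} (hu : u ∈ S) (hw : w ∉ S) (huw : G.Adj u w) :
    ∃ S' H' F', IsBlockUnion G S' H' F' ∧ S ⊂ S' := by
  obtain ⟨B, D, F₀, hB, hvert, hD, hreach⟩ := he.exists_isBlockUnion_of_adj hsc huw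
  have hDuw : D.Adj u w := (hD u w).mpr (Or.inl rfl)
  have huB : u ∈ B := hB.mem _ _ hDuw
  have hwB : w ∈ B := hB.mem _ _ hDuw.symm
  have hSB : ∀ x ∈ S, x ∈ B → x = u := by
    intro x hx hxB
    by_contra hxu
    exact hxu (h.inter_block hu hw huw hB.le hx (hreach x hxB hxu))
  have hHw : ¬ H.Adj u w := fun hH => hw (h.mem _ _ hH.symm)
  have hFu : F.Adj (u, 0) (u, 1) := (h.vertical u hu).resolve_right fun hall => hHw (hall w huw)
  obtain ⟨y, hy⟩ := h.exists_adj u hu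
  have hne : ∀ v, v ≠ u → s((v, (0 : Fin 2)), (v, (1 : Fin 2))) ∉
      ({s((u, 0), (u, 1))} : Set (Sym2 (V × Fin 2))) := by
    intro v hv heq
    rcases Sym2.eq_iff.mp heq with ⟨h1, -⟩ | ⟨h1, -⟩ <;> exact hv (congrArg Prod.fst h1)
  refine ⟨S ∪ B, H ⊔ D, _, ⟨sup_le h.le hB.le, ?_, ?_, ?_, ?_,
    h.cycle.merge hB.cycle hu huB hSB hFu (hvert u huB), ?_⟩,
    Set.ssubset_iff_of_subset Set.subset_union_left |>.mpr ⟨w, Or.inr hwB, hw⟩⟩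
  · rintro a b (hab | hab)
    exacts [Or.inl (h.mem a b hab), Or.inr (hB.mem a b hab)]
  · rintro v (hv | hv)
    · exact (h.exists_adj v hv).imp fun _ => Or.inl
    · exact (hB.exists_adj v hv).imp fun _ => Or.inr
  · have key : ∀ a ∈ S ∪ B, (H ⊔ D).Reachable a u := by
      rintro a (ha | ha)
      · exact (h.reach a u ha hu).mono le_sup_left
      · exact (hB.reach a u ha huB).mono le_sup_right
    exact fun a b ha hb => (key a ha).trans (key b hb).symm
  · rintro a b c d (hab | hab) hs
    exacts [Or.inl (h.closed a b c d hab hs), Or.inr (hB.closed a b c d hab hs)]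
  · intro v hv
    by_cases hvu : v = u
    · subst hvu
      right
      intro z hz
      rcases hsc.exists_sameBlock (v := v) (h.le hy) huw hz (Sym2.mem_mk_left _ _)
        (Sym2.mem_mk_left _ _) (Sym2.mem_mk_left _ _) with hs | hs | hs
      · exact absurd (h.closed _ _ _ _ hy hs) hHw
      · exact Or.inl (h.closed _ _ _ _ hy hs)
      · exact Or.inr ((hD v z).mpr hs)
    · rcases hv with hv | hv
      · refine (h.vertical v hv).imp (fun hF => ?_) fun hall z hz => Or.inl (hall z hz)
        exact deleteEdges_adj.mpr ⟨Or.inl hF, hne v hvu⟩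
      · exact Or.inl (deleteEdges_adj.mpr ⟨Or.inr (hvert v hv), hne v hvu⟩)

theorem EvenCycles.exists_isPrismCycle_univ [Finite V] [Nontrivial V] {G : SimpleGraph V}
    (hsc : IsSemiCactus G) (he : EvenCycles G) : ∃ F, IsPrismCycle G Set.univ F := by
  let good : Set (Set V) := {S | S.Nonempty ∧ ∃ H F, IsBlockUnion G S H F}
  obtain ⟨v⟩ := hsc.1.nonempty
  obtain ⟨w, hvw⟩ := hsc.1.preconnected.exists_adj_of_nontrivial v
  obtain ⟨B, D, F₀, hB, -, hD, -⟩ := he.exists_isBlockUnion_of_adj hsc hvw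
  have hgood : good.Nonempty :=
    ⟨B, ⟨v, hB.mem _ _ ((hD v w).mpr (Or.inl rfl))⟩, D, F₀, hB⟩
  obtain ⟨S, ⟨⟨a, ha⟩, H, F, hS⟩, hmax⟩ := (Set.toFinite good).exists_maximal hgood
  have hall : S = Set.univ := by
    by_contra hS'
    obtain ⟨b, hb⟩ := (Set.ne_univ_iff_exists_notMem S).mp hS'
    obtain ⟨p⟩ := hsc.1.preconnected a b
    obtain ⟨d, -, hd1, hd2⟩ := p.exists_boundary_dart S ha hb
    obtain ⟨S', H', F', h', hlt⟩ := hS.exists_extension hsc he hd1 hd2 d.adj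
    exact hlt.not_subset (hmax ⟨⟨a, hlt.subset ha⟩, H', F', h'⟩ hlt.subset)
  subst hall
  exact ⟨F, hS.cycle⟩

theorem IsPrismCycle.isHamiltonian [Fintype V] [DecidableEq V] [Nonempty V] {G : SimpleGraph V}
    {F : SimpleGraph (V × Fin 2)} (h : IsPrismCycle G Set.univ F) :
    (G.boxProd (⊤ : SimpleGraph (Fin 2))).IsHamiltonian := by
  obtain ⟨v⟩ := ‹Nonempty V›
  refine IsHamiltonian.mono h.le fun _ => ?_
  have hn : (F.neighborSet (v, 0)).Nonempty := by
    apply Set.nonempty_of_ncard_ne_zero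
    rw [h.ncard _ (Set.mem_univ _)]
    norm_num
  obtain ⟨p, hp, hverts⟩ := h.isCycles.exists_cycle_toSubgraph_verts_eq_connectedComponentSupp
    (c := F.connectedComponentMk (v, 0)) rfl hn
  refine ⟨_, p, hp, hp.isPath_tail.isHamiltonian_of_mem fun x => ?_⟩
  have hx : x ∈ p.support := by
    rw [← p.mem_verts_toSubgraph, hverts, ConnectedComponent.mem_supp_iff,
      ConnectedComponent.eq]
    exact h.reach _ _ (Set.mem_univ _) (Set.mem_univ _)
  rw [p.support_tail_of_not_nil hp.not_nil]
  rcases p.mem_support_iff.mp hx with rfl | hx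
  exacts [p.end_mem_tail_support hp.not_nil, hx]

/-- The prism over a finite even semi-cactus with at least two vertices is
Hamiltonian. -/
theorem semiCactus_prism_hamiltonian {V : Type u} [Fintype V] [DecidableEq V] (G : SimpleGraph V)
    (hsc : IsSemiCactus G) (he : EvenCycles G) (h2 : 1 < Fintype.card V) :
    (G.boxProd (⊤ : SimpleGraph (Fin 2))).IsHamiltonian := by
  have : Nontrivial V := Fintype.one_lt_card_iff_nontrivial.mp h2
  obtain ⟨F, hF⟩ := he.exists_isPrismCycle_univ hsc
  exact hF.isHamiltonian

end IGraph
end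

section
/- Let G be an infinite locally finite connected graph and k ≥ 1 an integer. Then G is a faithful spanning subgraph of its k-th power G^k. -/
namespace IGraph

open SimpleGraph

universe u w

variable {V : Type u} {W : Type w}

/-- The vertices of `G` at distance at most `k` from some vertex of `S`. -/
def nearSet (G : SimpleGraph V) (k : ℕ) (S : Set V) : Set V :=
  {v | ∃ s ∈ S, ∃ p : G.Walk s v, p.length ≤ k}

lemma subset_nearSet (G : SimpleGraph V) (k : ℕ) (S : Set V) : S ⊆ nearSet G k S :=
  fun s hs => ⟨s, hs, Walk.nil, Nat.zero_le k⟩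

lemma LocFin.finite_nearSet {G : SimpleGraph V} (hlf : LocFin G) (k : ℕ) {S : Set V}
    (hS : S.Finite) : (nearSet G k S).Finite := by
  induction k generalizing S with
  | zero =>
    refine hS.subset ?_
    rintro v ⟨s, hs, p, hp⟩
    exact p.eq_of_length_eq_zero (Nat.le_zero.mp hp) ▸ hs
  | succ k ih =>
    refine (hS.union (ih (hS.biUnion fun s _ => hlf s))).subset ?_
    rintro v ⟨s, hs, p, hp⟩
    cases p with
    | nil => exact Or.inl hs
    | cons h p =>
      refine Or.inr ⟨_, Set.mem_biUnion hs h, p, ?_⟩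
      simpa using hp

lemma reachable_del_of_walk {G : SimpleGraph V} {k : ℕ} {S : Set V} {u v : V} (p : G.Walk u v)
    (hp : p.length ≤ k) (hv : v ∉ nearSet G k S) : (del G S).Reachable u v := by
  induction p with
  | nil => exact Reachable.refl _
  | cons h p ih =>
    have hp' : p.length ≤ k := by
      rw [Walk.length_cons] at hp
      omega
    have hadj : (del G S).Adj _ _ :=
      ⟨h, fun hu => hv ⟨_, hu, Walk.cons h p, hp⟩, fun hw => hv ⟨_, hw, p, hp'⟩⟩
    exact hadj.reachable.trans (ih hp' hv)

lemma le_gpow (G : SimpleGraph V) {k : ℕ} (hk : 1 ≤ k) : G ≤ gpow G k :=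
  fun _ _ h => ⟨h.ne, h.toWalk, by simpa using hk⟩

lemma del_mono {F G : SimpleGraph V} (h : F ≤ G) (S : Set V) : del F S ≤ del G S :=
  fun _ _ hab => ⟨h hab.1, hab.2⟩

lemma RayEquiv.mono {F G : SimpleGraph V} (h : F ≤ G) {R₁ R₂ : ℕ → V}
    (hR : RayEquiv F R₁ R₂) : RayEquiv G R₁ R₂ := fun S hS =>
  let ⟨m, n, hm, hn, hmn⟩ := hR S hS
  ⟨m, n, hm, hn, hmn.mono (del_mono h S)⟩

lemma reachable_del_of_reachable_del_gpow {G : SimpleGraph V} {k : ℕ} {S : Set V} {u v : V}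
    (h : (del (gpow G k) (nearSet G k S)).Reachable u v) : (del G S).Reachable u v := by
  obtain ⟨p⟩ := h
  induction p with
  | nil => exact Reachable.refl _
  | cons h _ ih =>
    obtain ⟨⟨-, q, hq⟩, -, hw⟩ := h
    exact (reachable_del_of_walk q hq hw).trans ih

lemma LocFin.rayEquiv_of_gpow {G : SimpleGraph V} (hlf : LocFin G) {k : ℕ} {R₁ R₂ : ℕ → V}
    (hR : RayEquiv (gpow G k) R₁ R₂) : RayEquiv G R₁ R₂ := fun S hS =>
  let ⟨m, n, hm, hn, hmn⟩ := hR _ (hlf.finite_nearSet k hS)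
  ⟨m, n, fun i hi h => hm i hi (subset_nearSet G k S h),
    fun j hj h => hn j hj (subset_nearSet G k S h), reachable_del_of_reachable_del_gpow hmn⟩

/-- A ray of `G ^ k` is followed at distance at most `k` by an infinite walk of `G`. -/
lemma exists_walk_following {G : SimpleGraph V} {k : ℕ} {R : ℕ → V} (hR : IsRay (gpow G k) R) :
    ∃ (W : ℕ → V) (f : ℕ → ℕ), (∀ i, G.Adj (W i) (W (i + 1))) ∧
      (∀ i, ∃ p : G.Walk (W i) (R (f i)), p.length ≤ k) ∧ Filter.Tendsto f .atTop .atTop := by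
  -- A state is a triple `(v, n, d)` with a walk of length `d ≤ k` from `v` to `R n`.
  let State := {s : V × ℕ × ℕ // s.2.2 ≤ k ∧ ∃ p : G.Walk s.1 (R s.2.1), p.length = s.2.2}
  have step : ∀ s : State, ∃ t : State, G.Adj s.1.1 t.1.1 ∧
      ((t.1.2.1 = s.1.2.1 ∧ t.1.2.2 + 1 = s.1.2.2) ∨ t.1.2.1 = s.1.2.1 + 1) := by
    rintro ⟨⟨v, n, d⟩, hd, p, hp⟩
    dsimp only at hd p hp
    cases p with
    | nil =>
      obtain ⟨hne, q, hq⟩ := hR.2 n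
      obtain ⟨w, h, q', rfl⟩ := Walk.exists_eq_cons_of_ne hne q
      rw [Walk.length_cons] at hq
      exact ⟨⟨(w, n + 1, q'.length), by dsimp only; omega, q', rfl⟩, h, Or.inr rfl⟩
    | cons h p =>
      rw [Walk.length_cons] at hp
      exact ⟨⟨(_, n, p.length), by dsimp only; omega, p, rfl⟩, h, Or.inl ⟨rfl, hp⟩⟩
  choose next hadj hnext using step
  let σ : ℕ → State := fun i => next^[i] ⟨(R 0, 0, 0), Nat.zero_le k, Walk.nil, rfl⟩
  have hσ : ∀ i, σ (i + 1) = next (σ i) := fun i => Function.iterate_succ_apply' next i _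
  have hbound : ∀ i, i + (σ i).1.2.2 ≤ (k + 1) * (σ i).1.2.1 := by
    intro i
    induction i with
    | zero => exact le_refl 0
    | succ i ih =>
      have hd := (σ (i + 1)).2.1
      rw [hσ] at hd ⊢
      rcases hnext (σ i) with ⟨h₁, h₂⟩ | h₁
      · rw [h₁]
        omega
      · rw [h₁, mul_add]
        omega
  refine ⟨fun i => (σ i).1.1, fun i => (σ i).1.2.1, fun i => ?_, fun i => ?_, ?_⟩
  · dsimp only
    rw [hσ]
    exact hadj _
  · obtain ⟨hd, p, hp⟩ := (σ i).2
    exact ⟨p, hp.trans_le hd⟩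
  · refine Filter.tendsto_atTop.2 fun b => ?_
    filter_upwards [Filter.eventually_ge_atTop ((k + 1) * b)] with i hi
    have := hbound i
    exact Nat.le_of_mul_le_mul_left (by omega : (k + 1) * b ≤ _) k.succ_pos

/-- An infinite walk visiting each vertex finitely often contains a ray. -/
lemma exists_isRay_comp {G : SimpleGraph V} {W : ℕ → V} (hW : ∀ i, G.Adj (W i) (W (i + 1)))
    (hfin : Filter.Tendsto W .atTop .cofinite) :
    ∃ t : ℕ → ℕ, StrictMono t ∧ IsRay G (W ∘ t) := by
  have hlast : ∀ i, ∃ l, i ≤ l ∧ W l = W i ∧ ∀ j, l < j → W j ≠ W l := by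
    intro i
    obtain ⟨N, hN⟩ := Filter.eventually_atTop.1
      (hfin.eventually (Filter.eventually_cofinite_ne (W i)))
    have hi : i ≤ N := by
      by_contra h
      exact hN i (by omega) rfl
    classical
    have hg : W (Nat.findGreatest (fun l => W l = W i) N) = W i :=
      Nat.findGreatest_spec (P := fun l => W l = W i) hi rfl
    refine ⟨_, Nat.le_findGreatest (P := fun l => W l = W i) hi rfl, hg, fun j hj hji => ?_⟩
    rcases le_total j N with h | h
    · exact Nat.findGreatest_is_greatest hj h (hji.trans hg)
    · exact hN j h (hji.trans hg)
  choose last hle heq hgt using hlast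
  let t : ℕ → ℕ := fun n => Nat.rec (last 0) (fun _ m => last (m + 1)) n
  have ht : ∀ n, t (n + 1) = last (t n + 1) := fun _ => rfl
  have htm : StrictMono t := strictMono_nat_of_lt_succ fun n => hle (t n + 1)
  have htgt : ∀ n j, t n < j → W j ≠ W (t n) := by
    rintro (_ | n) <;> exact hgt _
  refine ⟨t, htm, Function.Injective.of_lt_imp_ne fun a b hab => (htgt a _ (htm hab)).symm,
    fun n => ?_⟩
  simp only [Function.comp_apply, ht, heq]
  exact hW _

/-- Every end of `G ^ k` contains a ray of `G`. -/
lemma LocFin.exists_isRay_rayEquiv_gpow {G : SimpleGraph V} (hlf : LocFin G) {k : ℕ} (hk : 1 ≤ k)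
    {R : ℕ → V} (hR : IsRay (gpow G k) R) :
    ∃ R' : ℕ → V, IsRay G R' ∧ RayEquiv (gpow G k) R R' := by
  obtain ⟨W, f, hW, hp, hf⟩ := exists_walk_following hR
  have hRfin : Filter.Tendsto R .atTop .cofinite := Nat.cofinite_eq_atTop ▸ hR.1.tendsto_cofinite
  have hR_near : ∀ S : Set V, S.Finite → ∀ᶠ n in .atTop, R n ∉ nearSet G k S := fun S hS =>
    hRfin.eventually (hlf.finite_nearSet k hS).eventually_cofinite_notMem
  have hWfin : ∀ S : Set V, S.Finite → ∀ᶠ i in .atTop, W i ∉ S := by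
    intro S hS
    filter_upwards [hf.eventually (hR_near S hS)] with i hi hiS
    obtain ⟨p, hpk⟩ := hp i
    exact hi ⟨W i, hiS, p, hpk⟩
  have hWtend : Filter.Tendsto W .atTop .cofinite := fun A hA => by
    simpa using hWfin Aᶜ hA
  obtain ⟨t, ht, hray⟩ := exists_isRay_comp hW hWtend
  refine ⟨W ∘ t, hray, fun S hS => ?_⟩
  have hRS := Filter.eventually_forall_ge_atTop.2 (hR_near S hS)
  have hWS := Filter.eventually_forall_ge_atTop.2 (hWfin S hS)
  obtain ⟨n, hn₁, hn₂⟩ :=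
    ((ht.tendsto_atTop.eventually (hf.eventually hRS)).and (ht.tendsto_atTop.eventually hWS)).exists
  refine ⟨f (t n), n, fun i hi h => hn₁ i hi (subset_nearSet G k S h),
    fun j hj => hn₂ _ (ht.monotone hj), ?_⟩
  obtain ⟨p, hpk⟩ := hp (t n)
  exact ((reachable_del_of_walk p hpk (hn₁ _ le_rfl)).mono (del_mono (le_gpow G hk) S)).symm

/-- For `G` infinite locally finite connected and `k ≥ 1`, `G` is a
faithful spanning subgraph of its `k`-th power `G^k`. -/
theorem power_faithful {V : Type u} (G : SimpleGraph V)
    (hinf : Infinite V) (hlf : LocFin G) (hconn : G.Connected)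
    (k : ℕ) (hk : 1 ≤ k) :
    G ≤ gpow G k ∧ Faithful G (gpow G k) := by
  refine ⟨le_gpow G hk, fun R hR => hlf.exists_isRay_rayEquiv_gpow hk hR, fun R₁ R₂ _ _ => ?_⟩
  exact ⟨RayEquiv.mono (le_gpow G hk), hlf.rayEquiv_of_gpow⟩

end IGraph
end

section
/- Let G be an infinite locally finite connected graph and F a subgraph of G that is faithful to G. Then the line graph L(F) is a faithful subgraph of the line graph L(G). -/
namespace IGraph

open SimpleGraph

universe u w

variable {V : Type u} {W : Type w}

section LineGraphRays

variable {G H K F : SimpleGraph V}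

lemma lineSub_self (G : SimpleGraph V) : lineSub G G = G.lineGraph := by
  ext e f
  simp only [lineSub, lineGraph_adj_iff_exists, e.2, f.2, true_and]

lemma lineSub_mono (h : F ≤ K) : lineSub G F ≤ lineSub G K := fun _ _ hef =>
  ⟨edgeSet_mono h hef.1, edgeSet_mono h hef.2.1, hef.2.2⟩

lemma IsRay.mono (h : F ≤ K) {R : ℕ → V} (hR : IsRay F R) : IsRay K R :=
  ⟨hR.1, fun n => h (hR.2 n)⟩

/-- An injective sequence eventually avoids any finite set. -/
lemma exists_tail_notMem {R : ℕ → V} (hR : Function.Injective R) {S : Set V} (hS : S.Finite) :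
    ∃ m, ∀ i, m ≤ i → R i ∉ S := by
  have h := hR.tendsto_cofinite.eventually hS.compl_mem_cofinite
  rw [Nat.cofinite_eq_atTop, Filter.eventually_atTop] at h
  exact h

lemma IsRay.reachable_del {R : ℕ → V} (hR : IsRay G R) {S : Set V} {m k : ℕ}
    (hm : ∀ i, m ≤ i → R i ∉ S) (hk : m ≤ k) : (del G S).Reachable (R m) (R k) := by
  induction k, hk using Nat.le_induction with
  | base => exact .rfl
  | succ k hk ih =>
    exact ih.trans (Adj.reachable (G := del G S) ⟨hR.2 k, hm k hk, hm _ (by omega)⟩)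

/-- Loop erasure: a lazy walk visiting each vertex finitely often has a subsequence which is
a ray. -/
lemma exists_ray_subsequence {x : ℕ → V} (hx : ∀ n, x n = x (n + 1) ∨ H.Adj (x n) (x (n + 1)))
    (hfin : ∀ v, {n | x n = v}.Finite) : ∃ φ : ℕ → ℕ, StrictMono φ ∧ IsRay H (x ∘ φ) := by
  have hlast : ∀ n, ∃ m, n ≤ m ∧ x m = x n ∧ ∀ j, m < j → x j ≠ x n := by
    intro n
    obtain ⟨m, hm, hmax⟩ := Set.exists_max_image _ id (hfin (x n)) ⟨n, rfl⟩
    exact ⟨m, hmax n rfl, hm, fun j hj h => (hmax j h).not_gt hj⟩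
  choose last hle heq hne using hlast
  let φ : ℕ → ℕ := fun k => Nat.rec (last 0) (fun _ p => last (p + 1)) k
  have hsucc : ∀ k, φ (k + 1) = last (φ k + 1) := fun _ => rfl
  have hφne : ∀ k j, φ k < j → x j ≠ x (φ k) := by
    rintro (_ | k) j hj
    · exact fun h => hne 0 j hj (h.trans (heq 0))
    · exact fun h => hne (φ k + 1) j hj (h.trans (heq _))
  have hmono : StrictMono φ := strictMono_nat_of_lt_succ fun k => hle (φ k + 1)
  refine ⟨φ, hmono, fun a b hab => ?_, fun k => ?_⟩
  · rcases lt_trichotomy a b with h | h | h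
    · exact absurd hab.symm (hφne a _ (hmono h))
    · exact h
    · exact absurd hab (hφne b _ (hmono h))
  · have h : H.Adj (x (φ k)) (x (φ k + 1)) :=
      (hx (φ k)).resolve_left fun h => hφne k (φ k + 1) (Nat.lt_succ_self _) h.symm
    simpa only [Function.comp_apply, hsucc, heq] using h

/-- Locally finite graphs have finitely many edges at every vertex. -/
lemma LocFin.finite_incident (hlf : LocFin G) (v : V) :
    {e : G.edgeSet | v ∈ (e : Sym2 V)}.Finite := by
  refine Set.Finite.of_finite_image (f := Subtype.val) (((hlf v).image fun w => s(v, w)).subset ?_)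
    Subtype.val_injective.injOn
  rintro _ ⟨⟨e, he⟩, hv, rfl⟩
  obtain ⟨w, rfl⟩ := Sym2.mem_iff_exists.mp hv
  exact ⟨w, he, rfl⟩

/-- The sequence `R` of vertices runs along the sequence `Q` of edges. -/
def RunsAlong (R : ℕ → V) (Q : ℕ → G.edgeSet) : Prop :=
  ∃ φ : ℕ → ℕ, StrictMono φ ∧ ∀ k, R k ∈ (Q (φ k) : Sym2 V)

lemma eq_or_adj_of_mem {e : Sym2 V} (he : e ∈ H.edgeSet) {u v : V} (hu : u ∈ e) (hv : v ∈ e) :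
    u = v ∨ H.Adj u v := by
  by_cases h : u = v
  · exact .inl h
  · rw [(Sym2.mem_and_mem_iff h).mp ⟨hu, hv⟩] at he
    exact .inr he

/-- Every ray of the line graph of a subgraph `H` has a ray of `H` running along it. -/
lemma exists_ray_runsAlong (hlf : LocFin G) {Q : ℕ → G.edgeSet} (hQ : IsRay (lineSub G H) Q) :
    ∃ R, IsRay H R ∧ RunsAlong R Q := by
  choose x hx hx' using fun n => (hQ.2 n).2.2.2
  obtain ⟨φ, hφ, hR⟩ := exists_ray_subsequence (H := H) (x := x)
    (fun n => eq_or_adj_of_mem (hQ.2 n).2.1 (hx' n) (hx (n + 1)))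
    (fun v => ((hlf.finite_incident v).preimage hQ.1.injOn).subset
      fun n hn => by simpa [← show x n = v from hn] using hx n)
  exact ⟨x ∘ φ, hR, φ, hφ, fun k => hx (φ k)⟩

/-- Every ray of a subgraph `H` of `G` runs along a ray of the line graph of `H`. -/
lemma exists_lineSub_ray_runsAlong (hHG : H ≤ G) {R : ℕ → V} (hR : IsRay H R) :
    ∃ Q : ℕ → G.edgeSet, IsRay (lineSub G H) Q ∧ RunsAlong R Q := by
  have hinj : Function.Injective fun n => s(R n, R (n + 1)) := by
    intro a b hab
    rcases Sym2.eq_iff.mp hab with ⟨h, -⟩ | ⟨h, h'⟩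
    · exact hR.1 h
    · have := hR.1 h
      have := hR.1 h'
      omega
  refine ⟨fun n => ⟨s(R n, R (n + 1)), hHG (hR.2 n)⟩, ⟨fun a b hab => ?_, fun n => ?_⟩,
    id, strictMono_id, fun k => Sym2.mem_mk_left _ _⟩
  · exact hinj (congrArg Subtype.val hab)
  · refine ⟨hR.2 n, hR.2 (n + 1), fun h => ?_, R (n + 1), Sym2.mem_mk_right _ _,
      Sym2.mem_mk_left _ _⟩
    have := hinj (congrArg Subtype.val h)
    omega

lemma reachable_del_lineSub (hKG : K ≤ G) {S : Set G.edgeSet} {T : Set V}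
    (hST : ∀ e ∈ S, ∀ v ∈ (e : Sym2 V), v ∈ T) {u v : V} (h : (del K T).Reachable u v)
    (hu : u ∉ T) {e f : G.edgeSet} (he : (e : Sym2 V) ∈ K.edgeSet) (hf : (f : Sym2 V) ∈ K.edgeSet)
    (hue : u ∈ (e : Sym2 V)) (hvf : v ∈ (f : Sym2 V)) :
    (del (lineSub G K) S).Reachable e f := by
  have key : ∀ {w : V} {e f : G.edgeSet}, w ∉ T → (e : Sym2 V) ∈ K.edgeSet →
      (f : Sym2 V) ∈ K.edgeSet → w ∈ (e : Sym2 V) → w ∈ (f : Sym2 V) →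
      (del (lineSub G K) S).Reachable e f := by
    intro w e f hw he hf hwe hwf
    by_cases hef : e = f
    · exact hef ▸ .rfl
    · exact Adj.reachable (G := del (lineSub G K) S) ⟨⟨he, hf, hef, w, hwe, hwf⟩,
        fun h => hw (hST e h w hwe), fun h => hw (hST f h w hwf)⟩
  obtain ⟨p⟩ := h
  induction p generalizing e with
  | nil => exact key hu he hf hue hvf
  | @cons a b c hab p ih =>
    have hg : s(a, b) ∈ K.edgeSet := hab.1
    exact (key (f := ⟨s(a, b), edgeSet_mono hKG hg⟩) hu he hg hue (Sym2.mem_mk_left _ _)).trans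
      (ih hab.2.2 hg (Sym2.mem_mk_right _ _) hvf)

lemma reachable_del_of_lineSub {S : Set G.edgeSet} {T : Set V}
    (hTS : ∀ e : G.edgeSet, ∀ v ∈ (e : Sym2 V), v ∈ T → e ∈ S) {e f : G.edgeSet}
    (h : (del (lineSub G K) S).Reachable e f) (he : (e : Sym2 V) ∈ K.edgeSet) (heS : e ∉ S)
    {u v : V} (hue : u ∈ (e : Sym2 V)) (hvf : v ∈ (f : Sym2 V)) :
    (del K T).Reachable u v := by
  have key : ∀ {e : G.edgeSet} {u v : V}, (e : Sym2 V) ∈ K.edgeSet → e ∉ S →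
      u ∈ (e : Sym2 V) → v ∈ (e : Sym2 V) → (del K T).Reachable u v := by
    intro e u v he heS hu hv
    rcases eq_or_adj_of_mem he hu hv with rfl | huv
    · exact .rfl
    · exact Adj.reachable (G := del K T)
        ⟨huv, fun h => heS (hTS e u hu h), fun h => heS (hTS e v hv h)⟩
  obtain ⟨p⟩ := h
  induction p generalizing u with
  | nil => exact key he heS hue hvf
  | cons hab p ih =>
    obtain ⟨x, hxa, hxb⟩ := hab.1.2.2.2
    exact (key he heS hue hxa).trans (ih hab.1.2.1 hab.2.2 hxb hvf)

/-- Passing to the line graph preserves and reflects equivalence of rays. -/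
lemma rayEquiv_lineSub_iff (hlf : LocFin G) (hKG : K ≤ G) {R₁ R₂ : ℕ → V} {Q₁ Q₂ : ℕ → G.edgeSet}
    (hR₁ : IsRay K R₁) (hR₂ : IsRay K R₂)
    (hQ₁ : IsRay (lineSub G K) Q₁) (hQ₂ : IsRay (lineSub G K) Q₂)
    (h₁ : RunsAlong R₁ Q₁) (h₂ : RunsAlong R₂ Q₂) :
    RayEquiv (lineSub G K) Q₁ Q₂ ↔ RayEquiv K R₁ R₂ := by
  obtain ⟨φ, hφ, hφR⟩ := h₁
  obtain ⟨ψ, hψ, hψR⟩ := h₂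
  constructor
  · intro h T hT
    let S : Set G.edgeSet := ⋃ v ∈ T, {e | v ∈ (e : Sym2 V)}
    have hTS : ∀ e : G.edgeSet, ∀ v ∈ (e : Sym2 V), v ∈ T → e ∈ S := fun e v hv hvT =>
      Set.mem_biUnion hvT hv
    obtain ⟨m, n, hm, hn, hmn⟩ := h S (hT.biUnion fun v _ => hlf.finite_incident v)
    obtain ⟨k, hk⟩ := exists_tail_notMem hR₁.1 hT
    obtain ⟨l, hl⟩ := exists_tail_notMem hR₂.1 hT
    have hmk : m ≤ φ (max m k) := (le_max_left _ _).trans (hφ.id_le _)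
    have hnl : n ≤ ψ (max n l) := (le_max_left _ _).trans (hψ.id_le _)
    refine ⟨max m k, max n l, fun i hi => hk i (le_of_max_le_right hi),
      fun i hi => hl i (le_of_max_le_right hi), ?_⟩
    exact reachable_del_of_lineSub hTS
      (((hQ₁.reachable_del hm hmk).symm.trans hmn).trans (hQ₂.reachable_del hn hnl))
      (hQ₁.2 _).1 (hm _ hmk) (hφR _) (hψR _)
  · intro h S hS
    let T : Set V := ⋃ e ∈ S, {v | v ∈ (e : Sym2 V)}
    have hST : ∀ e ∈ S, ∀ v ∈ (e : Sym2 V), v ∈ T := fun e he v hv => Set.mem_biUnion he hv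
    have hT : T.Finite := hS.biUnion fun e _ => by
      classical
      exact (e : Sym2 V).toFinset.finite_toSet.subset fun v hv => by simpa using hv
    obtain ⟨m, n, hm, hn, hmn⟩ := h T hT
    obtain ⟨k, hk⟩ := exists_tail_notMem hQ₁.1 hS
    obtain ⟨l, hl⟩ := exists_tail_notMem hQ₂.1 hS
    have hmk : m ≤ max m k := le_max_left _ _
    have hnl : n ≤ max n l := le_max_left _ _
    refine ⟨φ (max m k), ψ (max n l),
      fun i hi => hk i (((le_max_right _ _).trans (hφ.id_le _)).trans hi),
      fun i hi => hl i (((le_max_right _ _).trans (hψ.id_le _)).trans hi), ?_⟩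
    exact reachable_del_lineSub hKG hST
      (((hR₁.reachable_del hm hmk).symm.trans hmn).trans (hR₂.reachable_del hn hnl))
      (hm _ hmk) (hQ₁.2 _).1 (hQ₂.2 _).1 (hφR _) (hψR _)

end LineGraphRays

/-- If `F` is a subgraph of the infinite locally finite connected graph `G`
that is faithful to `G`, then the line graph `L(F)` is a faithful subgraph of the line
graph `L(G)`. -/
theorem lineGraph_faithful {V : Type u} (G F : SimpleGraph V)
    (hinf : Infinite V) (hlf : LocFin G) (hconn : G.Connected)
    (hFG : F ≤ G) (hfaith : Faithful F G) :
    lineSub G F ≤ G.lineGraph ∧ Faithful (lineSub G F) G.lineGraph := by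
  rw [← lineSub_self]
  refine ⟨lineSub_mono hFG, fun Q hQ => ?_, fun Q₁ Q₂ hQ₁ hQ₂ => ?_⟩
  · obtain ⟨R, hR, hRQ⟩ := exists_ray_runsAlong hlf hQ
    obtain ⟨R', hR', hRR'⟩ := hfaith.1 R hR
    obtain ⟨Q', hQ', hRQ'⟩ := exists_lineSub_ray_runsAlong hFG hR'
    exact ⟨Q', hQ', (rayEquiv_lineSub_iff hlf le_rfl hR (hR'.mono hFG) hQ
      (hQ'.mono (lineSub_mono hFG)) hRQ hRQ').mpr hRR'⟩
  · obtain ⟨R₁, hR₁, h₁⟩ := exists_ray_runsAlong hlf hQ₁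
    obtain ⟨R₂, hR₂, h₂⟩ := exists_ray_runsAlong hlf hQ₂
    rw [rayEquiv_lineSub_iff hlf hFG hR₁ hR₂ hQ₁ hQ₂ h₁ h₂,
      rayEquiv_lineSub_iff hlf le_rfl (hR₁.mono hFG) (hR₂.mono hFG)
        (hQ₁.mono (lineSub_mono hFG)) (hQ₂.mono (lineSub_mono hFG)) h₁ h₂]
    exact hfaith.2 R₁ R₂ hR₁ hR₂

end IGraph
end
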